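/- Let n ≥ 1, let a ∈ ℝ^n be ℚ-independent, let b ∈ ℝ^n, and suppose the flow generated by the constant vector field a is smoothly semiconjugate to the flow generated by the constant vector field b by a surjective map V : T^n → T^n (V admits a C^∞ lift W with (DW(x))a = b for all x). Suppose moreover that there exist ϑ ∈ ℝ∖{0} and a subfield F ⊆ ℝ with [F : ℚ] = n such that ϑa_1,…,ϑa_n all lie in F and form a basis of F as a ℚ-vector space. Then ϑb_1,…,ϑb_n also lie in F and form a basis of F as a ℚ-vector space (i.e. the semiconjugated flow is also algebraic, for the same field F). -/

import Mathlib

noncomputable section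

/-- Euclidean space `ℝ^n`. -/
abbrev Eucl (n : ℕ) := Fin n → ℝ

/-- The inclusion of the integer lattice `ℤ^n` into `ℝ^n`. -/
def intVec {n : ℕ} (m : Fin n → ℤ) : Eucl n := fun i => (m i : ℝ)

/-- The integer lattice `ℤ^n` as an additive subgroup of `ℝ^n`. -/
def intLattice (n : ℕ) : AddSubgroup (Eucl n) where
  carrier := Set.range (intVec (n := n))
  add_mem' := by
    rintro _ _ ⟨p, rfl⟩ ⟨q, rfl⟩
    exact ⟨p + q, by funext i; simp [intVec]⟩
  zero_mem' := ⟨0, by funext i; simp [intVec]⟩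
  neg_mem' := by
    rintro _ ⟨p, rfl⟩
    exact ⟨-p, by funext i; simp [intVec]⟩

/-- The `n`-torus `T^n = ℝ^n / ℤ^n`. -/
abbrev Torus (n : ℕ) := Eucl n ⧸ intLattice n

/-- The covering projection `π : ℝ^n → T^n`. -/
def torusPi (n : ℕ) : Eucl n → Torus n := QuotientAddGroup.mk

/-- `W : ℝ^n → ℝ^n` is a lift of `V : T^n → T^n`, i.e. `V ∘ π = π ∘ W`. -/
def IsLift {n : ℕ} (V : Torus n → Torus n) (W : Eucl n → Eucl n) : Prop :=
  ∀ x, V (torusPi n x) = torusPi n (W x)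

/-- An integer matrix viewed as a real matrix. -/
def matR {n : ℕ} (B : Matrix (Fin n) (Fin n) ℤ) : Matrix (Fin n) (Fin n) ℝ :=
  B.map Int.cast

/-- `W` is a `C^∞` diffeomorphism of `ℝ^n`. -/
def SmoothDiffeoR {n : ℕ} (W : Eucl n → Eucl n) : Prop :=
  ContDiff ℝ (⊤ : ℕ∞) W ∧ ∃ W' : Eucl n → Eucl n, ContDiff ℝ (⊤ : ℕ∞) W' ∧
    Function.LeftInverse W' W ∧ Function.RightInverse W' W

/-- The components of `a ∈ ℝ^n` are linearly independent over `ℚ`. -/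
def QIndep {n : ℕ} (a : Eucl n) : Prop := LinearIndependent ℚ a

/-- `R` is a generalized symmetry, with multiplier `α`, of the flow on `T^n` generated by the
constant vector field `a`: `R` is a diffeomorphism of the torus (a bijection admitting a smooth
diffeomorphism lift) and a lift `R̂` satisfies `(DR̂(x))a = αa` for all `x`. -/
def IsGenSym {n : ℕ} (a : Eucl n) (α : ℝ) (R : Torus n → Torus n) : Prop :=
  Function.Bijective R ∧ ∃ Rh : Eucl n → Eucl n, IsLift R Rh ∧ SmoothDiffeoR Rh ∧
    ∀ x, fderiv ℝ Rh x a = α • a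

/-- The multiplier group `M_a ⊆ ℝ \ {0}` of the flow generated by the constant vector field `a`. -/
def Mgroup {n : ℕ} (a : Eucl n) : Set ℝ :=
  {α | α ≠ 0 ∧ ∃ R : Torus n → Torus n, IsGenSym a α R}

/-- The flow generated by the constant vector field `a` is smoothly semiconjugate to the flow
generated by the constant vector field `b` by the surjective map `V : T^n → T^n`: `V` admits a
`C^∞` lift `W` with `(DW(x))a = b` for all `x`. -/
def SmoothSemiconj {n : ℕ} (a b : Eucl n) (V : Torus n → Torus n) : Prop :=
  Function.Surjective V ∧ ∃ W : Eucl n → Eucl n, IsLift V W ∧ ContDiff ℝ (⊤ : ℕ∞) W ∧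
    ∀ x, fderiv ℝ W x a = b

/-- The numbers `ϑ * a 1, …, ϑ * a n` all lie in the subfield `F` of `ℝ` and form a basis of `F`
as a vector space over `ℚ`. -/
def IsAlgebraicFreq {n : ℕ} (a : Eucl n) (ϑ : ℝ) (F : Subfield ℝ) : Prop :=
  (∀ i, ϑ * a i ∈ F) ∧ LinearIndependent ℚ (fun i => ϑ * a i) ∧
    ∀ y ∈ F, ∃ q : Fin n → ℚ, y = ∑ i, (q i : ℝ) * (ϑ * a i)

open MeasureTheory

/-- A continuous `ℤ^n`-periodic function on `ℝ^n` descends to the torus `(ℝ/ℤ)^n`. -/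
theorem exists_continuousMap_unitAddTorus {n : ℕ} {E : Type*} [TopologicalSpace E]
    {g : Eucl n → E} (hg : Continuous g)
    (hper : ∀ x (m : Fin n → ℤ), g (x + intVec m) = g x) :
    ∃ G : C(UnitAddTorus (Fin n), E), ∀ x : Eucl n, G (fun i => (x i : UnitAddCircle)) = g x := by
  have hq : IsOpenQuotientMap
      (Pi.map (fun (_ : Fin n) (x : ℝ) => (x : UnitAddCircle))) :=
    IsOpenQuotientMap.piMap fun _ => QuotientAddGroup.isOpenQuotientMap_mk
  let p : C(Eucl n, UnitAddTorus (Fin n)) := ⟨_, hq.continuous⟩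
  have hp : Topology.IsQuotientMap p := hq.isQuotientMap
  have hfac : Function.FactorsThrough (⟨g, hg⟩ : C(Eucl n, E)) p := by
    intro x y hxy
    have hm : ∀ i, ∃ m : ℤ, (m : ℝ) = -x i + y i := fun i => by
      have := QuotientAddGroup.eq.1 (congrFun hxy i)
      simpa [AddSubgroup.mem_zmultiples_iff] using this
    choose m hm using hm
    have hy : y = x + intVec m := by
      funext i
      simp [intVec, hm]
    simp [hy, hper]
  exact ⟨hp.lift ⟨g, hg⟩ hfac, DFunLike.congr_fun (hp.lift_comp ⟨g, hg⟩ hfac)⟩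

/-- A continuous function on the torus which is invariant under a linear flow with
`ℚ`-independent frequency vector is constant. -/
theorem UnitAddTorus.eq_of_flow_invariant {n : ℕ} {a : Eucl n} (ha : QIndep a)
    (G : C(UnitAddTorus (Fin n), ℂ))
    (hG : ∀ (t : ℝ) y, G (y + fun i => ((t * a i : ℝ) : UnitAddCircle)) = G y)
    (y z : UnitAddTorus (Fin n)) : G y = G z := by
  have hcoeff : ∀ m : Fin n → ℤ, m ≠ 0 → mFourierCoeff G m = 0 := by
    intro m hm
    have hs : ∑ i, (m i : ℝ) * a i ≠ 0 := fun h => hm <| by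
      have := Fintype.linearIndependent_iff.1 ha (fun i => (m i : ℚ))
        (by simpa [Rat.smul_def] using h)
      funext i
      exact_mod_cast this i
    set t : ℝ := 1 / (2 * ∑ i, (m i : ℝ) * a i) with ht
    set s : UnitAddTorus (Fin n) := fun i => ((t * a i : ℝ) : UnitAddCircle)
    have hadd : ∀ y, mFourier (-m) (y + s) = mFourier (-m) s * mFourier (-m) y := fun y => by
      simp [mFourier, fourier_apply, smul_add, AddCircle.toCircle_add, Finset.prod_mul_distrib,
        mul_comm]
    have hval : mFourier (-m) s = -1 := by
      have h1 : ∀ i, fourier ((-m) i) (s i) =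
          Complex.exp (2 * Real.pi * Complex.I * ((-m) i : ℤ) * (t * a i : ℝ) / (1 : ℝ)) :=
        fun i => fourier_coe_apply
      simp only [mFourier, ContinuousMap.coe_mk, h1]
      rw [← Complex.exp_sum, ← Complex.exp_neg_pi_mul_I]
      congr 1
      have h2 : t * ∑ i, (m i : ℝ) * a i = 1 / 2 := by
        rw [ht]; field_simp
      have h3 : (t : ℂ) * ∑ i, (m i : ℂ) * a i = 1 / 2 := by
        simpa using congrArg Complex.ofReal h2
      calc _ = -(2 * Real.pi * Complex.I) * ((t : ℂ) * ∑ i, (m i : ℂ) * a i) := by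
            simp only [Finset.mul_sum]
            refine Finset.sum_congr rfl fun i _ => ?_
            push_cast [Pi.neg_apply]
            ring
        _ = _ := by rw [h3]; ring
    have key : mFourierCoeff G m = mFourier (-m) s * mFourierCoeff G m := by
      change ∫ y, mFourier (-m) y • G y ∂(Measure.pi fun _ => AddCircle.haarAddCircle) =
        mFourier (-m) s *
          ∫ y, mFourier (-m) y • G y ∂(Measure.pi fun _ => AddCircle.haarAddCircle)
      rw [← integral_const_mul]
      refine (integral_add_right_eq_self _ s).symm.trans (integral_congr_ae (.of_forall fun y => ?_))
      simp only [hadd, show G (y + s) = G y from hG t y, smul_eq_mul, mul_assoc]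
    rw [hval] at key
    linear_combination key / 2
  have hsum : Summable (mFourierCoeff G) :=
    summable_of_ne_finset_zero (s := {0}) fun m hm => hcoeff m (by simpa using hm)
  have hconst : ∀ y, G y = mFourierCoeff G 0 := fun y => by
    have h1 := hasSum_mFourier_series_apply_of_summable hsum y
    have h2 := hasSum_single (f := fun i => mFourierCoeff G i • mFourier i y) 0
      fun m hm => by simp [hcoeff m hm]
    simpa [mFourier_zero] using h1.unique h2
  rw [hconst, hconst]

/-- A continuous periodic function on `ℝ^n` which grows linearly along a quasiperiodic flow is
constant, and its rate of growth vanishes. -/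
theorem eq_zero_and_const_of_periodic_of_flow {n : ℕ} {a : Eucl n} (ha : QIndep a)
    {g : Eucl n → ℝ} (hg : Continuous g) (hper : ∀ x (m : Fin n → ℤ), g (x + intVec m) = g x)
    {c : ℝ} (hflow : ∀ x (t : ℝ), g (x + t • a) = g x + t * c) :
    c = 0 ∧ ∀ x, g x = g 0 := by
  obtain ⟨G, hG⟩ := exists_continuousMap_unitAddTorus
    (g := fun x => (g x : ℂ)) (Complex.continuous_ofReal.comp hg) (fun x m => by simp [hper])
  have hc : c = 0 := by
    by_contra hc
    have hb : ∀ x, |g x| ≤ ‖G‖ := fun x => by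
      simpa [hG] using G.norm_coe_le_norm (fun i => (x i : UnitAddCircle))
    have h1 := hflow 0 ((2 * ‖G‖ + 1) / c)
    rw [div_mul_cancel₀ _ hc] at h1
    linarith [abs_le.1 (hb 0), abs_le.1 (hb (0 + ((2 * ‖G‖ + 1) / c) • a))]
  refine ⟨hc, fun x => ?_⟩
  have hinv : ∀ (t : ℝ) y, G (y + fun i => ((t * a i : ℝ) : UnitAddCircle)) = G y := by
    intro t y
    have hy : ∀ i, ∃ x : ℝ, (x : UnitAddCircle) = y i := fun i => QuotientAddGroup.mk_surjective _
    choose x hx using hy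
    obtain rfl : (fun i => (x i : UnitAddCircle)) = y := funext hx
    have h1 := hG (x + t • a)
    rw [hflow, hc, mul_zero, add_zero, ← hG x] at h1
    exact h1
  have h := UnitAddTorus.eq_of_flow_invariant ha G hinv
    (fun i => (x i : UnitAddCircle)) (fun i => ((0 : Eucl n) i : UnitAddCircle))
  rw [hG, hG] at h
  exact_mod_cast h

theorem torusPi_eq_iff {n : ℕ} {x y : Eucl n} :
    torusPi n x = torusPi n y ↔ ∃ m : Fin n → ℤ, y = x + intVec m := by
  rw [torusPi, QuotientAddGroup.eq]
  constructor
  · rintro ⟨m, hm⟩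
    exact ⟨m, by rw [hm]; abel⟩
  · rintro ⟨m, rfl⟩
    exact ⟨m, by abel⟩

theorem intVec_add {n : ℕ} (p q : Fin n → ℤ) : intVec (p + q) = intVec p + intVec q := by
  funext i
  simp [intVec]

/-- A continuous lift of a torus map commutes with integer translations up to an integer matrix. -/
theorem IsLift.exists_matrix {n : ℕ} {V : Torus n → Torus n} {W : Eucl n → Eucl n}
    (h : IsLift V W) (hW : Continuous W) :
    ∃ B : Matrix (Fin n) (Fin n) ℤ, ∀ x (m : Fin n → ℤ),
      W (x + intVec m) = W x + intVec (B.mulVec m) := by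
  have hex : ∀ m : Fin n → ℤ, ∃ p : Fin n → ℤ, ∀ x, W (x + intVec m) = W x + intVec p := by
    intro m
    have h1 : ∀ x, ∃ p : Fin n → ℤ, W (x + intVec m) = W x + intVec p := fun x => by
      rw [← torusPi_eq_iff, ← h, ← h, torusPi_eq_iff.2 ⟨m, rfl⟩]
    choose p hp using h1
    have hcont : Continuous p := by
      refine continuous_pi fun i => ?_
      rw [Int.isClosedEmbedding_coe_real.isInducing.continuous_iff]
      have : (Int.cast ∘ fun x => p x i : Eucl n → ℝ) = fun x => W (x + intVec m) i - W x i := by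
        funext x
        simp [hp, intVec]
      rw [this]
      fun_prop
    exact ⟨p 0, fun x => by rw [hp, PreconnectedSpace.constant inferInstance hcont (y := 0)]⟩
  choose φ hφ using hex
  have hinj : Function.Injective (intVec (n := n)) := fun p q hpq => by
    funext i
    exact Int.cast_injective (α := ℝ) (congrFun hpq i)
  let Φ : (Fin n → ℤ) →+ (Fin n → ℤ) := AddMonoidHom.mk' φ fun p q => hinj <| by
    have h1 := hφ (p + q) 0
    rw [intVec_add, ← add_assoc, hφ q, hφ p, add_assoc, add_right_inj] at h1
    rw [intVec_add, h1]
  refine ⟨LinearMap.toMatrix' Φ.toIntLinearMap, fun x m => ?_⟩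
  rw [LinearMap.toMatrix'_mulVec]
  exact hφ m x

/-- A smooth semiconjugacy from a quasiperiodic flow is affine, with invertible integer linear
part. -/
theorem SmoothSemiconj.exists_matrix {n : ℕ} {a b : Eucl n} {V : Torus n → Torus n}
    (ha : QIndep a) (h : SmoothSemiconj a b V) :
    ∃ B : Matrix (Fin n) (Fin n) ℤ, B.det ≠ 0 ∧ b = (matR B).mulVec a := by
  obtain ⟨hsurj, W, hlift, hsm, hder⟩ := h
  have hdiff : Differentiable ℝ W := hsm.differentiable (by simp)
  obtain ⟨B, hB⟩ := hlift.exists_matrix hsm.continuous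
  have hline : ∀ x (t : ℝ), W (x + t • a) = W x + t • b := by
    intro x t
    have hd : ∀ s : ℝ, HasDerivAt (fun s : ℝ => W (x + s • a) - s • b) 0 s := fun s => by
      have h1 : HasDerivAt (fun s : ℝ => x + s • a) a s := by
        simpa using ((hasDerivAt_id s).smul_const a).const_add x
      have h2 := (hdiff (x + s • a)).hasFDerivAt.comp_hasDerivAt s h1
      rw [hder] at h2
      have h3 := h2.sub ((hasDerivAt_id s).smul_const b)
      rw [one_smul, sub_self] at h3
      exact h3
    have := is_const_of_deriv_eq_zero (fun s => (hd s).differentiableAt) (fun s => (hd s).deriv) t 0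
    simpa [sub_eq_iff_eq_add] using this
  have hmul : ∀ m : Fin n → ℤ, intVec (B.mulVec m) = (matR B).mulVec (intVec m) := fun m => by
    funext i
    simp [intVec, matR, Matrix.mulVec, dotProduct]
  have key : ∀ j, b j - (matR B).mulVec a j = 0 ∧
      ∀ x, W x j - (matR B).mulVec x j = W 0 j - (matR B).mulVec 0 j := by
    intro j
    refine eq_zero_and_const_of_periodic_of_flow ha
      (g := fun x => W x j - (matR B).mulVec x j) ?_ ?_ ?_
    · have := hsm.continuous
      fun_prop
    · intro x m
      simp only [hB, hmul, Matrix.mulVec_add, Pi.add_apply]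
      ring
    · intro x t
      simp only [hline, Matrix.mulVec_add, Matrix.mulVec_smul, Pi.add_apply, Pi.smul_apply,
        smul_eq_mul]
      ring
  refine ⟨B, fun hdet => ?_, funext fun j => sub_eq_zero.1 (key j).1⟩
  obtain ⟨k, hk0, hk⟩ := Matrix.exists_vecMul_eq_zero_iff.2 hdet
  have haff : ∀ x, W x = (matR B).mulVec x + W 0 := fun x => by
    funext j
    have := (key j).2 x
    simp only [Matrix.mulVec_zero, Pi.zero_apply] at this
    simp only [Pi.add_apply]
    linarith
  have hkR : Matrix.vecMul (intVec k) (matR B) = 0 := by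
    funext j
    have := congrFun hk j
    simp only [Matrix.vecMul, dotProduct, Pi.zero_apply] at this
    simp only [Matrix.vecMul, dotProduct, intVec, matR, Matrix.map_apply, Pi.zero_apply]
    exact_mod_cast this
  have hint : ∀ y : Eucl n, ∃ z : ℤ, intVec k ⬝ᵥ y = intVec k ⬝ᵥ W 0 + z := by
    intro y
    obtain ⟨v, hv⟩ := hsurj (torusPi n y)
    obtain ⟨x, rfl⟩ : ∃ x, torusPi n x = v := QuotientAddGroup.mk_surjective v
    rw [hlift, torusPi_eq_iff] at hv
    obtain ⟨m, rfl⟩ := hv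
    refine ⟨k ⬝ᵥ m, ?_⟩
    rw [haff, dotProduct_add, dotProduct_add, Matrix.dotProduct_mulVec, hkR, zero_dotProduct,
      zero_add]
    simp [dotProduct, intVec]
  obtain ⟨i, hi⟩ := Function.ne_iff.1 hk0
  have hi' : (k i : ℝ) ≠ 0 := by exact_mod_cast hi
  obtain ⟨z, hz⟩ := hint 0
  obtain ⟨w, hw⟩ := hint (Pi.single i (1 / (2 * (k i : ℝ))))
  rw [dotProduct_zero] at hz
  rw [dotProduct_single] at hw
  have h2 : (k i : ℝ) * (1 / (2 * (k i : ℝ))) = 1 / 2 := by field_simp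
  simp only [intVec] at hw hz
  rw [h2] at hw
  have h3 : (1 : ℝ) = 2 * (w - z : ℤ) := by push_cast; linarith
  have h4 : (1 : ℤ) = 2 * (w - z) := by exact_mod_cast h3
  omega

/-- Being an algebraic frequency vector for `F` is preserved by nonsingular integer matrices. -/
theorem IsAlgebraicFreq.mulVec {n : ℕ} {a : Eucl n} {ϑ : ℝ} {F : Subfield ℝ}
    (h : IsAlgebraicFreq a ϑ F) {B : Matrix (Fin n) (Fin n) ℤ} (hB : B.det ≠ 0) :
    IsAlgebraicFreq ((matR B).mulVec a) ϑ F := by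
  obtain ⟨hmem, hli, hspan⟩ := h
  let Q : Matrix (Fin n) (Fin n) ℚ := B.map Int.cast
  have hQ : IsUnit Q.det := by
    have : Q.det = (B.det : ℚ) := by
      simpa using ((Int.castRingHom ℚ).map_det B).symm
    rw [this, isUnit_iff_ne_zero]
    exact_mod_cast hB
  have hcomp : ∀ i, ϑ * (matR B).mulVec a i = ∑ j, (B i j : ℝ) * (ϑ * a j) := fun i => by
    simp only [matR, Matrix.mulVec, dotProduct, Matrix.map_apply, Finset.mul_sum]
    exact Finset.sum_congr rfl fun j _ => by ring
  have hsum : ∀ q : Fin n → ℚ, ∑ i, (q i : ℝ) * (ϑ * (matR B).mulVec a i) =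
      ∑ j, ((Matrix.vecMul q Q j : ℚ) : ℝ) * (ϑ * a j) := fun q => by
    simp only [hcomp, Finset.mul_sum]
    rw [Finset.sum_comm]
    refine Finset.sum_congr rfl fun j _ => ?_
    simp only [Matrix.vecMul, dotProduct, Q, Matrix.map_apply, Rat.cast_sum, Rat.cast_mul,
      Rat.cast_intCast, Finset.sum_mul, mul_assoc]
  refine ⟨fun i => ?_, ?_, fun y hy => ?_⟩
  · rw [hcomp]
    exact sum_mem fun j _ => mul_mem (intCast_mem F _) (hmem j)
  · rw [Fintype.linearIndependent_iff] at hli ⊢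
    intro q hq
    simp only [Rat.smul_def] at hq hli
    have hz : Matrix.vecMul q Q = 0 := funext (hli _ ((hsum q).symm.trans hq))
    have : q = 0 := by
      rw [← Matrix.vecMul_one q, ← Matrix.mul_nonsing_inv Q hQ, ← Matrix.vecMul_vecMul, hz,
        Matrix.zero_vecMul]
    exact congrFun this
  · obtain ⟨q, rfl⟩ := hspan y hy
    refine ⟨Matrix.vecMul q Q⁻¹, ?_⟩
    rw [hsum, Matrix.vecMul_vecMul, Matrix.nonsing_inv_mul Q hQ, Matrix.vecMul_one]

/-- if in addition the flow of `a` is algebraic — `ϑ a_1, …, ϑ a_n` form a basis of a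
subfield `F ⊆ ℝ` of degree `n` over `ℚ` — then so is the flow of `b`, with the same field `F`. -/
theorem stmt_8 (n : ℕ) (hn : 1 ≤ n) (a b : Eucl n) (ha : QIndep a)
    (V : Torus n → Torus n) (hsc : SmoothSemiconj a b V)
    (ϑ : ℝ) (hϑ : ϑ ≠ 0) (F : Subfield ℝ) (hF : Module.finrank ℚ F = n)
    (halg : IsAlgebraicFreq a ϑ F) :
    IsAlgebraicFreq b ϑ F := by
  obtain ⟨B, hB, rfl⟩ := hsc.exists_matrix ha
  exact halg.mulVec hB
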